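/- Let β > 0, ε > 0 and γ > 0, and let Φ : [0,∞) → [0,∞) be monotone decreasing with ∫₀^∞ s^{γ} Φ(s) ds/s < ∞. Then lim_{t→0⁺} t^{ε/β} ∫₀^{t^{-1/β}} s^{γ+ε} Φ(s) ds/s = 0. -/

import Mathlib

open MeasureTheory Metric Filter Set ENNReal

/-- If `β, ε, γ > 0` and `Φ : [0,∞) → [0,∞)` is monotone decreasing
with `∫₀^∞ s^γ Φ(s) ds/s < ∞`, then
`t^{ε/β} ∫₀^{t^{-1/β}} s^{γ+ε} Φ(s) ds/s → 0` as `t → 0⁺`. -/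
theorem tendsto_weighted_moment_zero
    (β ε γ : ℝ) (hβ : 0 < β) (hε : 0 < ε) (hγ : 0 < γ)
    (Φ : ℝ → ℝ) (hΦ_nonneg : ∀ s ∈ Set.Ici (0 : ℝ), 0 ≤ Φ s)
    (hΦ_anti : AntitoneOn Φ (Set.Ici (0 : ℝ)))
    (hint : ∫⁻ s in Set.Ioi (0 : ℝ), ENNReal.ofReal (s ^ γ * Φ s / s) < ⊤) :
    Tendsto
      (fun t : ℝ => ENNReal.ofReal (t ^ (ε / β)) *
        ∫⁻ s in Set.Ioo (0 : ℝ) (t ^ (-(1 / β))),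
          ENNReal.ofReal (s ^ (γ + ε) * Φ s / s))
      (nhdsWithin 0 (Set.Ioi 0)) (nhds 0) := by
  have hM : Measurable (fun s : ℝ => Φ (max s 0)) := by
    apply Antitone.measurable
    intro a b hab
    exact hΦ_anti (Set.mem_Ici.2 (le_max_right a 0)) (Set.mem_Ici.2 (le_max_right b 0)) (max_le_max_right 0 hab)
  have hpow : Tendsto (fun t : ℝ => ENNReal.ofReal (t ^ (ε / β)))
      (nhdsWithin 0 (Set.Ioi 0)) (nhds 0) := by
    have h1 : Tendsto (fun t : ℝ => t ^ (ε / β)) (nhds 0) (nhds 0) := by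
      have := (Real.continuousAt_rpow_const (0 : ℝ) (ε / β) (Or.inr (by positivity))).tendsto
      rwa [Real.zero_rpow (by positivity)] at this
    have h2 := (ENNReal.continuous_ofReal.tendsto 0).comp h1
    rw [ENNReal.ofReal_zero] at h2
    exact h2.mono_left nhdsWithin_le_nhds
  have key : Tendsto
      (fun t : ℝ => ∫⁻ s in Set.Ioi (0 : ℝ), ENNReal.ofReal (t ^ (ε / β)) *
        (Set.Ioo (0 : ℝ) (t ^ (-(1 / β)))).indicator
          (fun s => ENNReal.ofReal (s ^ (γ + ε) * Φ (max s 0) / s)) s)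
      (nhdsWithin 0 (Set.Ioi 0)) (nhds (∫⁻ s in Set.Ioi (0 : ℝ), 0)) := by
    apply tendsto_lintegral_filter_of_dominated_convergence
      (fun s => ENNReal.ofReal (s ^ γ * Φ s / s))
    · refine Eventually.of_forall fun t => ?_
      apply Measurable.const_mul
      apply Measurable.indicator _ measurableSet_Ioo
      apply Measurable.ennreal_ofReal
      exact ((measurable_id.pow_const _).mul hM).div measurable_id
    · filter_upwards [self_mem_nhdsWithin] with t ht
      have ht : 0 < t := ht
      filter_upwards [ae_restrict_mem measurableSet_Ioi] with s hs
      have hs : 0 < s := hs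
      by_cases h : s ∈ Set.Ioo (0 : ℝ) (t ^ (-(1 / β)))
      · rw [Set.indicator_of_mem h, max_eq_left hs.le, ← ENNReal.ofReal_mul (by positivity)]
        apply ENNReal.ofReal_le_ofReal
        have h0 := hΦ_nonneg s hs.le
        have h1 : t ^ (ε / β) * s ^ ε ≤ 1 := by
          have h2 : s ^ ε ≤ (t ^ (-(1 / β))) ^ ε := Real.rpow_le_rpow hs.le h.2.le hε.le
          rw [← Real.rpow_mul ht.le] at h2
          calc t ^ (ε / β) * s ^ ε ≤ t ^ (ε / β) * t ^ (-(1 / β) * ε) := by gcongr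
            _ = 1 := by
              rw [← Real.rpow_add ht, show ε / β + -(1 / β) * ε = 0 by ring, Real.rpow_zero]
        rw [Real.rpow_add hs]
        calc t ^ (ε / β) * (s ^ γ * s ^ ε * Φ s / s)
            = (t ^ (ε / β) * s ^ ε) * (s ^ γ * Φ s / s) := by ring
          _ ≤ 1 * (s ^ γ * Φ s / s) := by gcongr
          _ = _ := one_mul _
      · rw [Set.indicator_of_notMem h, mul_zero]
        exact zero_le
    · exact hint.ne
    · refine Eventually.of_forall fun s => ?_
      have h := ENNReal.Tendsto.mul_const
        (b := ENNReal.ofReal (s ^ (γ + ε) * Φ (max s 0) / s)) hpow (Or.inr ENNReal.ofReal_ne_top)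
      rw [zero_mul] at h
      refine tendsto_of_tendsto_of_tendsto_of_le_of_le tendsto_const_nhds h
        (fun _ => zero_le) (fun t => ?_)
      exact mul_le_mul_right (Set.indicator_le_self _ _ _) _
  rw [lintegral_zero] at key
  refine key.congr fun t => ?_
  rw [lintegral_const_mul' _ _ ENNReal.ofReal_ne_top, lintegral_indicator measurableSet_Ioo,
    Measure.restrict_restrict measurableSet_Ioo,
    Set.inter_eq_left.2 (fun s hs => hs.1)]
  congr 1
  refine setLIntegral_congr_fun measurableSet_Ioo fun s hs => ?_
  simp only [max_eq_left hs.1.le]
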